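/- arXiv:2312.16593 — 3 statements merged into one kernel-verified Lean document; each statement's English description precedes it below -/
import Mathlib

section
/- Let G be a finite simple connected graph containing no C3 or C5 as a subgraph, and suppose that for every edge xy of G one has κ_LLY(x,y) ≥ κ for some real κ > 0. Then the number of vertices of G satisfies |V(G)| ≤ 2^{2/κ}. -/
open Finset

noncomputable section

/-- The (normalized) graph Laplacian `Δf(x) = (1/deg x) ∑_{y ~ x} (f y - f x)`. -/
def graphLap {V : Type*} [Fintype V] (G : SimpleGraph V) [DecidableRel G.Adj]
    (f : V → ℝ) (x : V) : ℝ :=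
  (G.degree x : ℝ)⁻¹ * ∑ y ∈ G.neighborFinset x, (f y - f x)

/-- `f` is 1-Lipschitz with respect to the graph distance. -/
def IsLip1 {V : Type*} (G : SimpleGraph V) (f : V → ℝ) : Prop :=
  ∀ u v : V, |f u - f v| ≤ G.dist u v

/-- Lin–Lu–Yau curvature of a pair of vertices, via the limit-free
(Münch–Wojciechowski) formulation. -/
def kappaLLY {V : Type*} [Fintype V] (G : SimpleGraph V) [DecidableRel G.Adj]
    (x y : V) : ℝ :=
  sInf { r : ℝ | ∃ f : V → ℝ, IsLip1 G f ∧ f y - f x = G.dist x y ∧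
      r = (graphLap G f x - graphLap G f y) / G.dist x y }

/-- `G` contains a cycle of length `n` as a subgraph: `n` distinct vertices
arranged cyclically so that consecutive ones are adjacent. -/
def HasCycleLen {V : Type*} (G : SimpleGraph V) (n : ℕ) [NeZero n] : Prop :=
  ∃ c : Fin n → V, Function.Injective c ∧ ∀ i : Fin n, G.Adj (c i) (c (i + 1))

/-- The generalized binomial coefficient `n (n - 1) ⋯ (n - k + 1) / k!` of a real number `n`. -/
def realChoose (n : ℝ) : ℕ → ℝ
  | 0 => 1
  | k + 1 => realChoose n k * (n - k) / (k + 1)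

lemma succ_mul_realChoose_succ (n : ℝ) (k : ℕ) :
    (k + 1) * realChoose n (k + 1) = n * realChoose (n - 1) k := by
  induction k with
  | zero => simp [realChoose]
  | succ k ih =>
    have h1 : realChoose n (k + 2) = realChoose n (k + 1) * (n - (k + 1 : ℕ)) / ((k + 1 : ℕ) + 1) :=
      rfl
    have h2 : realChoose (n - 1) (k + 1) = realChoose (n - 1) k * (n - 1 - k) / (k + 1) := rfl
    have h3 : (k : ℝ) + 1 ≠ 0 := by positivity
    have h4 : (k : ℝ) + 1 + 1 ≠ 0 := by positivity
    rw [h1, h2]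
    push_cast
    field_simp
    linear_combination (n - 1 - k) * ih

/-- Partial sums of the binomial series up to the exponent are bounded by the full power. -/
lemma sum_realChoose_le (N : ℕ) (n : ℝ) (hN : (N : ℝ) ≤ n) (x : ℝ) (hx : 0 ≤ x) :
    ∑ k ∈ range (N + 1), realChoose n k * x ^ k ≤ (1 + x) ^ n := by
  induction N generalizing n x with
  | zero =>
    simp only [zero_add, sum_range_one, realChoose, pow_zero, mul_one]
    exact Real.one_le_rpow (by linarith) (by simpa using hN)
  | succ N ih =>
    push_cast at hN
    have hn : 0 ≤ n := by linarith [Nat.cast_nonneg (α := ℝ) N]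
    let F : ℝ → ℝ := fun t => (1 + t) ^ n - ∑ k ∈ range (N + 2), realChoose n k * t ^ k
    let F' : ℝ → ℝ := fun t => n * (1 + t) ^ (n - 1) -
      ∑ k ∈ range (N + 2), realChoose n k * (k * t ^ (k - 1))
    have hF : ∀ t, 0 ≤ t → HasDerivAt F (F' t) t := by
      intro t ht
      refine HasDerivAt.sub ?_ ?_
      · have := ((hasDerivAt_id t).const_add 1).rpow_const (p := n) (Or.inl (by simp; linarith))
        simpa using this
      · exact HasDerivAt.fun_sum fun k _ => (hasDerivAt_pow k t).const_mul _
    have hF' : ∀ t, 0 ≤ t → 0 ≤ F' t := by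
      intro t ht
      have h := mul_le_mul_of_nonneg_left (ih (n - 1) (by linarith) t ht) hn
      have : ∑ k ∈ range (N + 2), realChoose n k * (k * t ^ (k - 1)) =
          n * ∑ k ∈ range (N + 1), realChoose (n - 1) k * t ^ k := by
        rw [sum_range_succ', mul_sum]
        simp only [Nat.cast_zero, zero_mul, mul_zero, add_zero]
        refine sum_congr rfl fun k _ => ?_
        have := succ_mul_realChoose_succ n k
        simp only [Nat.add_sub_cancel]
        push_cast
        linear_combination t ^ k * this
      simp only [F', this]
      linarith
    have hmono : MonotoneOn F (Set.Ici 0) := by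
      refine monotoneOn_of_deriv_nonneg (convex_Ici 0)
        (fun t ht => (hF t ht).continuousAt.continuousWithinAt) ?_ ?_
      · intro t ht
        rw [interior_Ici] at ht
        exact (hF t ht.le).differentiableAt.differentiableWithinAt
      · intro t ht
        rw [interior_Ici] at ht
        rw [(hF t ht.le).deriv]
        exact hF' t ht.le
    have h0 : F 0 = 0 := by
      simp only [F]
      rw [sum_range_succ']
      simp [realChoose]
    have := hmono (Set.mem_Ici.2 le_rfl) (Set.mem_Ici.2 hx) hx
    rw [h0] at this
    simp only [F] at this
    linarith

/-- McShane extension of a 1-Lipschitz function on a set of vertices. -/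
lemma exists_isLip1_extension {V : Type*} {G : SimpleGraph V} (hconn : G.Connected)
    (U : Finset V) (hU : U.Nonempty) (g : V → ℝ)
    (hg : ∀ u ∈ U, ∀ v ∈ U, g u - g v ≤ G.dist u v) :
    ∃ f : V → ℝ, IsLip1 G f ∧ ∀ u ∈ U, f u = g u := by
  let f : V → ℝ := fun w => U.inf' hU fun u => g u + G.dist u w
  have hf : ∀ v w, f v ≤ f w + G.dist v w := by
    intro v w
    obtain ⟨u, hu, hw⟩ := U.exists_mem_eq_inf' hU fun u => g u + (G.dist u w : ℝ)
    have h1 : f v ≤ g u + G.dist u v := U.inf'_le _ hu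
    have h2 : (G.dist u v : ℝ) ≤ G.dist u w + G.dist w v := by
      exact_mod_cast hconn.dist_triangle
    have h3 : f w = g u + G.dist u w := hw
    rw [G.dist_comm (u := w)] at h2
    linarith
  refine ⟨f, fun v w => abs_sub_le_iff.2 ⟨by linarith [hf v w], ?_⟩, fun u hu => ?_⟩
  · have := hf w v
    rw [G.dist_comm] at this
    linarith
  · refine le_antisymm ?_ ?_
    · simpa using U.inf'_le (fun v => g v + (G.dist v u : ℝ)) hu
    · refine U.le_inf' hU _ fun v hv => ?_
      have := hg u hu v hv
      rw [G.dist_comm] at this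
      linarith

lemma not_adj_of_common_neighbor {V : Type*} {G : SimpleGraph V} (h3 : ¬ HasCycleLen G 3)
    {x u v : V} (hu : G.Adj x u) (hv : G.Adj x v) : ¬ G.Adj u v := by
  intro h
  refine h3 ⟨![x, u, v], ?_, ?_⟩
  · have := hu.ne
    have := hv.ne
    have := h.ne
    intro i j
    fin_cases i <;> fin_cases j <;> simp_all [eq_comm]
  · intro i
    fin_cases i
    · exact hu
    · exact h
    · exact hv.symm

lemma not_common_neighbor_of_adj {V : Type*} {G : SimpleGraph V} (h3 : ¬ HasCycleLen G 3)
    (h5 : ¬ HasCycleLen G 5) {x y u v z : V} (hxy : G.Adj x y) (hu : G.Adj x u)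
    (hv : G.Adj y v) (huz : G.Adj u z) (hzv : G.Adj z v) (huy : u ≠ y) (hvx : v ≠ x) : False := by
  have huv : u ≠ v := by
    rintro rfl
    exact not_adj_of_common_neighbor h3 hxy hu hv
  have hzx : z ≠ x := by
    rintro rfl
    exact not_adj_of_common_neighbor h3 hxy hzv hv
  have hzy : z ≠ y := by
    rintro rfl
    exact not_adj_of_common_neighbor h3 hxy.symm huz.symm hu
  refine h5 ⟨![x, u, z, v, y], ?_, ?_⟩
  · have := hu.ne
    have := hxy.ne
    have := hv.ne
    have := huz.ne
    have := hzv.ne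
    intro i j
    fin_cases i <;> fin_cases j <;> simp_all [eq_comm]
  · intro i
    fin_cases i
    · exact hu
    · exact huz
    · exact hzv
    · exact hv.symm
    · exact hxy.symm

lemma exists_adj_adj_of_dist_eq_two {V : Type*} {G : SimpleGraph V} (hconn : G.Connected)
    {u v : V} (h : G.dist u v = 2) : ∃ z, G.Adj u z ∧ G.Adj z v := by
  obtain ⟨w, hw⟩ := hconn.exists_walk_length_eq_dist u v
  rw [h] at hw
  match w, hw with
  | .cons h1 (.cons h2 .nil), _ => exact ⟨_, h1, h2⟩

/-- A positive lower curvature bound gives a Laplacian comparison for functions defined only on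
the neighbourhoods of an edge. -/
lemma le_lap_sub_lap_of_edge {V : Type*} [Fintype V] {G : SimpleGraph V}
    [DecidableRel G.Adj] (hconn : G.Connected)
    (h3 : ¬ HasCycleLen G 3) (h5 : ¬ HasCycleLen G 5)
    {κ : ℝ} (hκ : 0 < κ) {x y : V} (hxy : G.Adj x y) (hcurv : κ ≤ kappaLLY G x y)
    (a : ℝ) (F K : V → ℝ)
    (hF : ∀ u, G.Adj x u → F u = a - 1 ∨ F u = a + 1)
    (hK : ∀ v, G.Adj y v → K v = a ∨ K v = a + 2)
    (hFy : F y = a + 1) (hKx : K x = a)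
    (hFK : ∀ u v, G.Adj x u → G.Adj y v → G.Adj u v → |F u - K v| ≤ 1) :
    κ ≤ (G.degree x : ℝ)⁻¹ * ∑ u ∈ G.neighborFinset x, (F u - a) -
      (G.degree y : ℝ)⁻¹ * ∑ v ∈ G.neighborFinset y, (K v - (a + 1)) := by
  classical
  let g : V → ℝ := fun w => if G.Adj x w then F w else K w
  have gF : ∀ u, G.Adj x u → g u = F u := fun u hu => if_pos hu
  have gK : ∀ v, G.Adj y v → g v = K v := fun v hv =>
    if_neg fun h => not_adj_of_common_neighbor h3 hxy h hv
  have two_le : ∀ z u v, G.Adj z u → G.Adj z v → u ≠ v → (2 : ℝ) ≤ G.dist u v := by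
    intro z u v hu hv huv
    have h0 := hconn.pos_dist_of_ne huv
    have h1 : G.dist u v ≠ 1 := fun h =>
      not_adj_of_common_neighbor h3 hu hv (SimpleGraph.dist_eq_one_iff_adj.1 h)
    have : 2 ≤ G.dist u v := by omega
    exact_mod_cast this
  have cross : ∀ u v, G.Adj x u → G.Adj y v → |F u - K v| ≤ G.dist u v := by
    intro u v hu hv
    by_cases huv : G.Adj u v
    · rw [SimpleGraph.dist_eq_one_iff_adj.2 huv]
      simpa using hFK u v hu hv huv
    · have hne : u ≠ v := by
        rintro rfl
        exact not_adj_of_common_neighbor h3 hxy hu hv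
      have huy : u ≠ y := by
        rintro rfl
        exact huv hv
      have hvx : v ≠ x := by
        rintro rfl
        exact huv hu.symm
      have h0 := hconn.pos_dist_of_ne hne
      have h1 : G.dist u v ≠ 1 := fun h => huv (SimpleGraph.dist_eq_one_iff_adj.1 h)
      have h2 : G.dist u v ≠ 2 := fun h => by
        obtain ⟨z, hz1, hz2⟩ := exists_adj_adj_of_dist_eq_two hconn h
        exact not_common_neighbor_of_adj h3 h5 hxy hu hv hz1 hz2 huy hvx
      have h : (3 : ℝ) ≤ G.dist u v := by
        have : 3 ≤ G.dist u v := by omega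
        exact_mod_cast this
      refine le_trans (abs_le.2 ?_) h
      rcases hF u hu with h | h <;> rcases hK v hv with h' | h' <;> rw [h, h'] <;>
        constructor <;> linarith
  obtain ⟨f, hf, hfg⟩ := exists_isLip1_extension hconn
    (G.neighborFinset x ∪ G.neighborFinset y) ⟨y, by simp [hxy]⟩ g (by
      intro u hu v hv
      simp only [mem_union, SimpleGraph.mem_neighborFinset] at hu hv
      by_cases huv : u = v
      · simp [huv]
      rcases hu with hu | hu <;> rcases hv with hv | hv
      · rw [gF u hu, gF v hv]
        refine le_trans ?_ (two_le x u v hu hv huv)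
        rcases hF u hu with h | h <;> rcases hF v hv with h' | h' <;> rw [h, h'] <;> linarith
      · rw [gF u hu, gK v hv]
        exact (abs_le.1 (cross u v hu hv)).2
      · rw [gK u hu, gF v hv, G.dist_comm]
        linarith [(abs_le.1 (cross v u hv hu)).1]
      · rw [gK u hu, gK v hv]
        refine le_trans ?_ (two_le y u v hu hv huv)
        rcases hK u hu with h | h <;> rcases hK v hv with h' | h' <;> rw [h, h'] <;> linarith)
  have fF : ∀ u, G.Adj x u → f u = F u := fun u hu => by
    rw [hfg u (by simp [hu]), gF u hu]
  have fK : ∀ v, G.Adj y v → f v = K v := fun v hv => by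
    rw [hfg v (by simp [hv]), gK v hv]
  have fx : f x = a := (fK x hxy.symm).trans hKx
  have fy : f y = a + 1 := (fF y hxy).trans hFy
  have hd : G.dist x y = 1 := SimpleGraph.dist_eq_one_iff_adj.2 hxy
  have hbdd : BddBelow { r : ℝ | ∃ f : V → ℝ, IsLip1 G f ∧ f y - f x = G.dist x y ∧
      r = (graphLap G f x - graphLap G f y) / G.dist x y } := by
    by_contra h
    have h' : kappaLLY G x y = 0 := Real.sInf_of_not_bddBelow h
    linarith
  have hle := hcurv.trans (csInf_le hbdd ⟨f, hf, by rw [fx, fy, hd]; simp, rfl⟩)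
  rw [hd, Nat.cast_one, div_one] at hle
  rw [graphLap, graphLap, fx, fy,
    sum_congr (s₁ := G.neighborFinset x) (g := fun u => F u - a) rfl
      fun u hu => by rw [fF u ((G.mem_neighborFinset x u).1 hu)],
    sum_congr (s₁ := G.neighborFinset y) (g := fun v => K v - (a + 1)) rfl
      fun v hv => by rw [fK v ((G.mem_neighborFinset y v).1 hv)]] at hle
  exact hle

/-- The bipartite double cover of a graph. -/
def doubleCover {V : Type*} (G : SimpleGraph V) : SimpleGraph (V × Bool) where
  Adj p q := G.Adj p.1 q.1 ∧ q.2 = !p.2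
  symm := ⟨fun p q h => ⟨h.1.symm, by simp [h.2]⟩⟩
  loopless := ⟨fun p h => h.1.ne rfl⟩

lemma even_walk_length_doubleCover {V : Type*} {G : SimpleGraph V} {p q : V × Bool}
    (w : (doubleCover G).Walk p q) : Even w.length ↔ p.2 = q.2 := by
  induction w with
  | nil => simp
  | @cons p q r h w ih =>
    rw [SimpleGraph.Walk.length_cons, Nat.even_add_one, ih, h.2]
    cases p.2 <;> cases r.2 <;> simp

lemma dist_doubleCover_of_adj {V : Type*} {G : SimpleGraph V} {r p q : V × Bool}
    (hp : (doubleCover G).Reachable r p) (h : (doubleCover G).Adj p q) :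
    (doubleCover G).dist r q = (doubleCover G).dist r p + 1 ∨
      (doubleCover G).dist r q + 1 = (doubleCover G).dist r p := by
  have hq := hp.trans h.reachable
  obtain ⟨v, hv⟩ := hp.exists_walk_length_eq_dist
  obtain ⟨w, hw⟩ := hq.exists_walk_length_eq_dist
  have h1 := SimpleGraph.dist_le (v.concat h)
  have h2 := SimpleGraph.dist_le (w.concat h.symm)
  rw [SimpleGraph.Walk.length_concat] at h1 h2
  have h3 := even_walk_length_doubleCover v
  have h4 := even_walk_length_doubleCover w
  have h5 : (doubleCover G).dist r q ≠ (doubleCover G).dist r p := by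
    intro h5
    rw [hv] at h3
    rw [hw, h5, h3, h.2] at h4
    revert h4
    cases r.2 <;> cases p.2 <;> simp
  omega

lemma exists_reachable_doubleCover {V : Type*} {G : SimpleGraph V} {x y : V} (w : G.Walk x y)
    (s : Bool) : ∃ t, (doubleCover G).Reachable (x, s) (y, t) := by
  induction w generalizing s with
  | nil => exact ⟨s, .refl _⟩
  | cons h w ih =>
    obtain ⟨t, ht⟩ := ih (!s)
    exact ⟨t, SimpleGraph.Reachable.trans
      (SimpleGraph.Adj.reachable (G := doubleCover G) ⟨h, rfl⟩) ht⟩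

lemma exists_adj_dist_eq {W : Type*} {H : SimpleGraph W} {r p : W} (hp : H.Reachable r p) {k : ℕ}
    (hk : H.dist r p = k + 1) : ∃ q, H.Adj q p ∧ H.Reachable r q ∧ H.dist r q = k := by
  obtain ⟨w, hw⟩ := hp.symm.exists_walk_length_eq_dist
  rw [H.dist_comm, hk] at hw
  match w, hw with
  | .cons (v := q) h v, hv =>
    have hq : H.Reachable r q := hp.trans h.reachable
    refine ⟨q, h.symm, hq, ?_⟩
    have h1 := SimpleGraph.dist_le v
    rw [H.dist_comm] at h1
    obtain ⟨u, hu⟩ := hq.exists_walk_length_eq_dist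
    have h2 := SimpleGraph.dist_le (u.concat h.symm)
    rw [SimpleGraph.Walk.length_concat] at h2
    rw [SimpleGraph.Walk.length_cons] at hv
    omega

lemma sum_neighborFinset_doubleCover {V : Type*} [Fintype V] {G : SimpleGraph V}
    [DecidableRel G.Adj] [DecidableRel (doubleCover G).Adj] {M : Type*} [AddCommMonoid M]
    (p : V × Bool) (φ : V × Bool → M) :
    ∑ q ∈ (doubleCover G).neighborFinset p, φ q = ∑ u ∈ G.neighborFinset p.1, φ (u, !p.2) := by
  symm
  refine sum_bij (fun u _ => (u, !p.2)) ?_ ?_ ?_ ?_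
  · intro u hu
    exact (SimpleGraph.mem_neighborFinset _ _ _).2 ⟨by simpa using hu, rfl⟩
  · intro u _ v _ h
    exact congrArg Prod.fst h
  · rintro ⟨u, s⟩ hq
    rw [SimpleGraph.mem_neighborFinset] at hq
    exact ⟨u, by simpa using hq.1, Prod.ext rfl hq.2.symm⟩
  · intro u _
    rfl

open scoped Classical in
/-- If along every sphere around `r` the proportion of inward edges at distance `k` is at least
`k / n` and all other edges go outward, then the component of a vertex `r` of minimum degree has
at most `2 ^ n` vertices. -/
lemma card_component_le {W : Type*} [Fintype W] (H : SimpleGraph W) (r : W) {n : ℝ}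
    (hn : 0 < n) (hr : 0 < H.degree r) (hmin : ∀ p, H.degree r ≤ H.degree p)
    (hstep : ∀ p q, H.Reachable r p → H.Adj p q →
      H.dist r q = H.dist r p + 1 ∨ H.dist r q + 1 = H.dist r p)
    (hin : ∀ p, H.Reachable r p → (H.dist r p : ℝ) * H.degree p ≤
      n * #{q ∈ H.neighborFinset p | H.dist r q + 1 = H.dist r p}) :
    (#{p | H.Reachable r p} : ℝ) ≤ 2 ^ n := by
  let S : ℕ → Finset W := fun k => {p | H.Reachable r p ∧ H.dist r p = k}
  let m : ℕ → ℝ := fun k => ∑ p ∈ S k, (H.degree p : ℝ)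
  have hS : ∀ k p, p ∈ S k ↔ H.Reachable r p ∧ H.dist r p = k := fun k p => by simp [S]
  have hdeg : ∀ p, (0 : ℝ) < H.degree p := fun p => by exact_mod_cast hr.trans_le (hmin p)
  have hle : ∀ p, H.Reachable r p → (H.dist r p : ℝ) ≤ n := by
    intro p hp
    have h1 : #{q ∈ H.neighborFinset p | H.dist r q + 1 = H.dist r p} ≤ H.degree p :=
      card_filter_le _ _
    have h2 : (#{q ∈ H.neighborFinset p | H.dist r q + 1 = H.dist r p} : ℝ) ≤ H.degree p := by
      exact_mod_cast h1
    exact le_of_mul_le_mul_right ((hin p hp).trans (mul_le_mul_of_nonneg_left h2 hn.le)) (hdeg p)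
  have habove : ∀ k, ∀ p ∈ S k, (S (k + 1)).bipartiteAbove H.Adj p =
      {q ∈ H.neighborFinset p | ¬ H.dist r q + 1 = H.dist r p} := by
    intro k p hp
    rw [hS] at hp
    ext q
    simp only [mem_bipartiteAbove, hS, mem_filter, SimpleGraph.mem_neighborFinset]
    constructor
    · rintro ⟨⟨h1, h2⟩, h3⟩
      exact ⟨h3, by omega⟩
    · rintro ⟨h1, h2⟩
      have := hstep p q hp.1 h1
      exact ⟨⟨hp.1.trans h1.reachable, by omega⟩, h1⟩
  have hbelow : ∀ k, ∀ p ∈ S (k + 1), (S k).bipartiteBelow H.Adj p =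
      {q ∈ H.neighborFinset p | H.dist r q + 1 = H.dist r p} := by
    intro k p hp
    rw [hS] at hp
    ext q
    simp only [mem_bipartiteBelow, hS, mem_filter, SimpleGraph.mem_neighborFinset]
    constructor
    · rintro ⟨⟨h1, h2⟩, h3⟩
      exact ⟨h3.symm, by omega⟩
    · rintro ⟨h1, h2⟩
      exact ⟨⟨hp.1.trans h1.reachable, by omega⟩, h1.symm⟩
  have hrec : ∀ k, (k + 1) * m (k + 1) ≤ (n - k) * m k := by
    intro k
    have hcount : (∑ p ∈ S k, (#((S (k + 1)).bipartiteAbove H.Adj p) : ℝ)) =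
        ∑ p ∈ S (k + 1), (#((S k).bipartiteBelow H.Adj p) : ℝ) := by
      exact_mod_cast sum_card_bipartiteAbove_eq_sum_card_bipartiteBelow H.Adj
    calc (k + 1) * m (k + 1)
        ≤ ∑ p ∈ S (k + 1), n * (#((S k).bipartiteBelow H.Adj p) : ℝ) := by
          rw [mul_sum]
          refine sum_le_sum fun p hp => ?_
          have h := hin p ((hS _ _).1 hp).1
          rw [hbelow k p hp]
          rw [((hS _ _).1 hp).2] at h ⊢
          exact_mod_cast h
      _ = ∑ p ∈ S k, n * (#((S (k + 1)).bipartiteAbove H.Adj p) : ℝ) := by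
          rw [← mul_sum, ← mul_sum, hcount]
      _ ≤ (n - k) * m k := by
          rw [mul_sum]
          refine sum_le_sum fun p hp => ?_
          rw [habove k p hp]
          have h := hin p ((hS _ _).1 hp).1
          have hsplit : (#{q ∈ H.neighborFinset p | H.dist r q + 1 = H.dist r p} : ℝ) +
              #{q ∈ H.neighborFinset p | ¬ H.dist r q + 1 = H.dist r p} = H.degree p := by
            exact_mod_cast card_filter_add_card_filter_not (s := H.neighborFinset p)
              fun q => H.dist r q + 1 = H.dist r p
          rw [((hS _ _).1 hp).2] at h hsplit ⊢
          rw [← hsplit] at h ⊢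
          linarith
  have hm0 : m 0 = H.degree r := by
    have : S 0 = {r} := by
      ext p
      rw [hS, mem_singleton]
      constructor
      · rintro ⟨h1, h2⟩
        exact (h1.dist_eq_zero_iff.1 h2).symm
      · rintro rfl
        exact ⟨.refl _, SimpleGraph.dist_self⟩
    simp [m, this]
  have hm : ∀ k : ℕ, (k : ℝ) ≤ n → m k ≤ H.degree r * realChoose n k := by
    intro k
    induction k with
    | zero => simp [hm0, realChoose]
    | succ k ih =>
      intro hk
      push_cast at hk
      have hk' : (0 : ℝ) < k + 1 := by positivity
      have h := (hrec k).trans (mul_le_mul_of_nonneg_left (ih (by linarith)) (by linarith))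
      rw [realChoose, ← mul_div_assoc, le_div_iff₀ hk']
      linarith
  have hfloor : (⌊n⌋₊ : ℝ) ≤ n := Nat.floor_le hn.le
  have hpow := sum_realChoose_le ⌊n⌋₊ n hfloor 1 zero_le_one
  have htotal : ∑ p ∈ ({p | H.Reachable r p} : Finset W), (H.degree p : ℝ) =
      ∑ k ∈ range (⌊n⌋₊ + 1), m k := by
    rw [← sum_fiberwise_of_maps_to (t := range (⌊n⌋₊ + 1)) (g := fun p => H.dist r p)]
    · refine sum_congr rfl fun k _ => sum_congr ?_ fun _ _ => rfl
      ext p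
      simp [hS]
    · intro p hp
      rw [mem_range, Nat.lt_succ_iff]
      exact Nat.le_floor (hle p (by simpa using hp))
  have hmain : (H.degree r : ℝ) * #{p | H.Reachable r p} ≤ H.degree r * 2 ^ n := by
    calc (H.degree r : ℝ) * #{p | H.Reachable r p}
        = ∑ p ∈ ({p | H.Reachable r p} : Finset W), (H.degree r : ℝ) := by
          rw [sum_const, nsmul_eq_mul, mul_comm]
      _ ≤ ∑ k ∈ range (⌊n⌋₊ + 1), m k := by
          rw [← htotal]
          exact sum_le_sum fun p _ => by exact_mod_cast hmin p
      _ ≤ ∑ k ∈ range (⌊n⌋₊ + 1), H.degree r * realChoose n k := by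
          refine sum_le_sum fun k hk => hm k (le_trans ?_ hfloor)
          rw [mem_range, Nat.lt_succ_iff] at hk
          exact_mod_cast hk
      _ ≤ H.degree r * 2 ^ n := by
          rw [← mul_sum]
          refine mul_le_mul_of_nonneg_left ?_ (hdeg r).le
          norm_num at hpow
          exact hpow
  exact le_of_mul_le_mul_left hmain (hdeg r)

/-- Laplacian comparison for the distance function on the double cover. -/
lemma lap_dist_doubleCover_le {V : Type*} [Fintype V] {G : SimpleGraph V}
    [DecidableRel G.Adj] (hconn : G.Connected)
    (h3 : ¬ HasCycleLen G 3) (h5 : ¬ HasCycleLen G 5) {κ : ℝ} (hκ : 0 < κ)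
    (hcurv : ∀ x y : V, G.Adj x y → κ ≤ kappaLLY G x y) (r : V × Bool) (k : ℕ) (p : V × Bool)
    (hp : (doubleCover G).Reachable r p) (hk : (doubleCover G).dist r p = k) :
    (G.degree p.1 : ℝ)⁻¹ *
      ∑ u ∈ G.neighborFinset p.1, (((doubleCover G).dist r (u, !p.2) : ℝ) - k) ≤ 1 - κ * k := by
  have hstep : ∀ (p : V × Bool) (u : V), (doubleCover G).Reachable r p → G.Adj p.1 u →
      (doubleCover G).dist r (u, !p.2) = (doubleCover G).dist r p + 1 ∨
      (doubleCover G).dist r (u, !p.2) + 1 = (doubleCover G).dist r p :=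
    fun p u hp hu => dist_doubleCover_of_adj hp ⟨hu, rfl⟩
  induction k generalizing p with
  | zero =>
    have h : ∑ u ∈ G.neighborFinset p.1, (((doubleCover G).dist r (u, !p.2) : ℝ) - (0 : ℕ)) =
        G.degree p.1 := by
      rw [sum_congr rfl (g := fun _ => (1 : ℝ))]
      · simp
      · intro u hu
        have := hstep p u hp (by simpa using hu)
        have h1 : (doubleCover G).dist r (u, !p.2) = 1 := by omega
        simp [h1]
    rw [h]
    simpa using inv_mul_le_one
  | succ k ih =>
    obtain ⟨q, hqp, hq, hqk⟩ := exists_adj_dist_eq hp hk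
    have hqp' := hqp.2
    have hpq' : q.2 = !p.2 := by rw [hqp']; simp
    have hih := ih q hq hqk
    have := le_lap_sub_lap_of_edge hconn h3 h5 hκ hqp.1 (hcurv _ _ hqp.1) k
      (fun u => ((doubleCover G).dist r (u, !q.2) : ℝ))
      (fun u => ((doubleCover G).dist r (u, !p.2) : ℝ))
      (by
        intro u hu
        rcases hstep q u hq hu with h | h
        · right
          rw [h, hqk]
          push_cast
          rfl
        · left
          rw [eq_sub_iff_add_eq]
          exact_mod_cast h.trans hqk)
      (by
        intro v hv
        rcases hstep p v hp hv with h | h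
        · right
          rw [h, hk]
          push_cast
          ring
        · left
          have : (doubleCover G).dist r (v, !p.2) = k := by omega
          rw [this])
      (by
        have : (p.1, !q.2) = p := Prod.ext rfl hqp'.symm
        rw [this, hk]
        push_cast
        rfl)
      (by
        have : (q.1, !p.2) = q := Prod.ext rfl hpq'.symm
        rw [this, hqk])
      (by
        intro u v hu hv huv
        have hr : (doubleCover G).Reachable r (u, !q.2) :=
          hq.trans (SimpleGraph.Adj.reachable (G := doubleCover G) ⟨hu, rfl⟩)
        have h := hstep (u, !q.2) v hr huv
        have he : (!(!q.2)) = !p.2 := by rw [hpq']; simp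
        simp only [he] at h
        rcases h with h | h
        · rw [h]
          push_cast
          rw [abs_le]
          constructor <;> linarith
        · rw [← h]
          push_cast
          rw [abs_le]
          constructor <;> linarith)
    push_cast
    linarith

theorem volume_bound_C3C5_free {V : Type*} [Fintype V] (G : SimpleGraph V)
    [DecidableRel G.Adj] (hconn : G.Connected)
    (h3 : ¬ HasCycleLen G 3) (h5 : ¬ HasCycleLen G 5)
    (κ : ℝ) (hκ : 0 < κ)
    (hcurv : ∀ x y : V, G.Adj x y → κ ≤ kappaLLY G x y) :
    (Fintype.card V : ℝ) ≤ 2 ^ (2 / κ) := by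
  classical
  have : Nonempty V := hconn.nonempty
  rcases subsingleton_or_nontrivial V with hV | hV
  · have h1 : (Fintype.card V : ℝ) ≤ 1 := by
      exact_mod_cast Fintype.card_le_one_iff_subsingleton.2 hV
    exact h1.trans (Real.one_le_rpow one_le_two (by positivity))
  obtain ⟨x, hx⟩ := G.exists_minimal_degree_vertex
  have hdeg : ∀ y, 0 < G.degree y := fun y => hconn.preconnected.degree_pos_of_nontrivial y
  have hmin : ∀ y, G.degree x ≤ G.degree y := fun y => hx ▸ G.minDegree_le_degree y
  let r : V × Bool := (x, false)
  have hcover : ∀ p, (doubleCover G).degree p = G.degree p.1 := by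
    intro p
    have := sum_neighborFinset_doubleCover (G := G) p fun _ => 1
    simpa using this
  refine le_trans ?_ (card_component_le (doubleCover G) r (n := 2 / κ) (by positivity) ?_ ?_ ?_ ?_)
  · rw [Nat.cast_le]
    refine card_le_card_of_surjOn Prod.fst fun y _ => ?_
    obtain ⟨w⟩ := hconn x y
    obtain ⟨t, ht⟩ := exists_reachable_doubleCover w false
    exact ⟨(y, t), by simpa using ht, rfl⟩
  · rw [hcover]
    exact hdeg x
  · intro p
    rw [hcover, hcover]
    exact hmin p.1
  · exact fun p q hp h => dist_doubleCover_of_adj hp h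
  · intro p hp
    have hd : (0 : ℝ) < G.degree p.1 := by exact_mod_cast hdeg p.1
    have hlap := lap_dist_doubleCover_le hconn h3 h5 hκ hcurv r _ p hp rfl
    rw [← sum_neighborFinset_doubleCover p fun q =>
      ((doubleCover G).dist r q : ℝ) - (doubleCover G).dist r p, inv_mul_le_iff₀ hd] at hlap
    have hsum : ∑ q ∈ (doubleCover G).neighborFinset p,
        (((doubleCover G).dist r q : ℝ) - (doubleCover G).dist r p) =
        G.degree p.1 - 2 * #{q ∈ (doubleCover G).neighborFinset p |
          (doubleCover G).dist r q + 1 = (doubleCover G).dist r p} := by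
      rw [card_filter, ← hcover, ← SimpleGraph.card_neighborFinset_eq_degree, card_eq_sum_ones]
      push_cast
      rw [mul_sum, ← sum_sub_distrib]
      refine sum_congr rfl fun q hq => ?_
      rcases dist_doubleCover_of_adj hp ((SimpleGraph.mem_neighborFinset _ _ _).1 hq) with h | h
      · rw [if_neg (by omega), h]
        push_cast
        ring
      · rw [if_pos h, ← h]
        push_cast
        ring
    rw [hsum] at hlap
    rw [hcover, div_mul_eq_mul_div, le_div_iff₀ hκ]
    linarith
end
end

section
/- Let G be a finite simple connected graph and let x ≠ y be vertices of G. The function α ↦ κ_α(x,y) is concave on the interval [0,1), i.e., for all α, β ∈ [0,1) and t ∈ [0,1], κ_{tα+(1−t)β}(x,y) ≥ t·κ_α(x,y) + (1−t)·κ_β(x,y). -/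
open Finset

noncomputable section

/-- `m` is a probability distribution on the (finite) vertex set. -/
def IsProb {V : Type*} [Fintype V] (m : V → ℝ) : Prop :=
  (∀ x, 0 ≤ m x ∧ m x ≤ 1) ∧ ∑ x, m x = 1

/-- `A` is a coupling between the distributions `m1` and `m2`. -/
def IsCoupling {V : Type*} [Fintype V] (m1 m2 : V → ℝ) (A : V → V → ℝ) : Prop :=
  (∀ x y, 0 ≤ A x y ∧ A x y ≤ 1) ∧ (∀ x, ∑ y, A x y = m1 x) ∧
    (∀ y, ∑ x, A x y = m2 y)

/-- The transportation distance between two distributions on the vertices of `G`. -/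
def transportDist {V : Type*} [Fintype V] (G : SimpleGraph V) (m1 m2 : V → ℝ) : ℝ :=
  sInf { r : ℝ | ∃ A : V → V → ℝ, IsCoupling m1 m2 A ∧
      r = ∑ x, ∑ y, A x y * G.dist x y }

/-- The `α`-lazy random walk distribution at the vertex `x`. -/
def lazyWalk {V : Type*} [Fintype V] [DecidableEq V] (G : SimpleGraph V)
    [DecidableRel G.Adj] (α : ℝ) (x : V) : V → ℝ :=
  fun v => if v = x then α else if G.Adj x v then (1 - α) / G.degree x else 0

/-- The `α`-Ricci curvature `κ_α(x,y) = 1 - W(m_x^α, m_y^α)/d(x,y)`. -/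
def kappaAlpha {V : Type*} [Fintype V] [DecidableEq V] (G : SimpleGraph V)
    [DecidableRel G.Adj] (α : ℝ) (x y : V) : ℝ :=
  1 - transportDist G (lazyWalk G α x) (lazyWalk G α y) / G.dist x y

lemma IsProb.isCoupling_mul {V : Type*} [Fintype V] {m₁ m₂ : V → ℝ} (h₁ : IsProb m₁)
    (h₂ : IsProb m₂) : IsCoupling m₁ m₂ fun x y => m₁ x * m₂ y := by
  refine ⟨fun x y => ⟨mul_nonneg (h₁.1 x).1 (h₂.1 y).1,
    mul_le_one₀ (h₁.1 x).2 (h₂.1 y).1 (h₂.1 y).2⟩, fun x => ?_, fun y => ?_⟩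
  · rw [← Finset.mul_sum, h₂.2, mul_one]
  · rw [← Finset.sum_mul, h₁.2, one_mul]

lemma IsCoupling.convex_comb {V : Type*} [Fintype V] {m₁ m₂ n₁ n₂ : V → ℝ} {A B : V → V → ℝ}
    (hA : IsCoupling m₁ m₂ A) (hB : IsCoupling n₁ n₂ B) {s t : ℝ} (hs : 0 ≤ s) (ht : 0 ≤ t)
    (hst : s + t = 1) :
    IsCoupling (fun v => s * m₁ v + t * n₁ v) (fun v => s * m₂ v + t * n₂ v)
      fun x y => s * A x y + t * B x y := by
  refine ⟨fun x y => ⟨?_, ?_⟩, fun x => ?_, fun y => ?_⟩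
  · exact add_nonneg (mul_nonneg hs (hA.1 x y).1) (mul_nonneg ht (hB.1 x y).1)
  · calc s * A x y + t * B x y ≤ s * 1 + t * 1 := by
          gcongr
          · exact (hA.1 x y).2
          · exact (hB.1 x y).2
      _ = 1 := by rw [mul_one, mul_one, hst]
  · rw [Finset.sum_add_distrib, ← Finset.mul_sum, ← Finset.mul_sum, hA.2.1, hB.2.1]
  · rw [Finset.sum_add_distrib, ← Finset.mul_sum, ← Finset.mul_sum, hA.2.2, hB.2.2]

lemma IsCoupling.transportDist_le {V : Type*} [Fintype V] (G : SimpleGraph V) {m₁ m₂ : V → ℝ}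
    {A : V → V → ℝ} (hA : IsCoupling m₁ m₂ A) :
    transportDist G m₁ m₂ ≤ ∑ x, ∑ y, A x y * G.dist x y := by
  refine csInf_le ⟨0, ?_⟩ ⟨A, hA, rfl⟩
  rintro r ⟨B, hB, rfl⟩
  exact Finset.sum_nonneg fun x _ => Finset.sum_nonneg fun y _ =>
    mul_nonneg (hB.1 x y).1 (Nat.cast_nonneg _)

lemma IsProb.exists_coupling_lt {V : Type*} [Fintype V] (G : SimpleGraph V) {m₁ m₂ : V → ℝ}
    (h₁ : IsProb m₁) (h₂ : IsProb m₂) {ε : ℝ} (hε : 0 < ε) :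
    ∃ A, IsCoupling m₁ m₂ A ∧
      ∑ x, ∑ y, A x y * G.dist x y < transportDist G m₁ m₂ + ε := by
  obtain ⟨r, ⟨A, hA, rfl⟩, hr⟩ := Real.lt_sInf_add_pos
    (s := { r : ℝ | ∃ A : V → V → ℝ, IsCoupling m₁ m₂ A ∧ r = ∑ x, ∑ y, A x y * G.dist x y })
    ⟨_, _, h₁.isCoupling_mul h₂, rfl⟩ hε
  exact ⟨A, hA, hr⟩

/-- The transportation distance is jointly convex in the two distributions. -/
lemma transportDist_convex_comb_le {V : Type*} [Fintype V] (G : SimpleGraph V)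
    {m₁ m₂ n₁ n₂ : V → ℝ} (hm₁ : IsProb m₁) (hm₂ : IsProb m₂) (hn₁ : IsProb n₁)
    (hn₂ : IsProb n₂) {s t : ℝ} (hs : 0 ≤ s) (ht : 0 ≤ t) (hst : s + t = 1) :
    transportDist G (fun v => s * m₁ v + t * n₁ v) (fun v => s * m₂ v + t * n₂ v) ≤
      s * transportDist G m₁ m₂ + t * transportDist G n₁ n₂ := by
  refine le_of_forall_pos_le_add fun ε hε => ?_
  obtain ⟨A, hA, hA'⟩ := hm₁.exists_coupling_lt G hm₂ hε
  obtain ⟨B, hB, hB'⟩ := hn₁.exists_coupling_lt G hn₂ hε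
  calc transportDist G (fun v => s * m₁ v + t * n₁ v) (fun v => s * m₂ v + t * n₂ v)
      ≤ ∑ x, ∑ y, (s * A x y + t * B x y) * G.dist x y :=
        (hA.convex_comb hB hs ht hst).transportDist_le G
    _ = s * ∑ x, ∑ y, A x y * G.dist x y + t * ∑ x, ∑ y, B x y * G.dist x y := by
        simp only [add_mul, Finset.sum_add_distrib, Finset.mul_sum, mul_assoc]
    _ ≤ s * (transportDist G m₁ m₂ + ε) + t * (transportDist G n₁ n₂ + ε) := by gcongr
    _ = s * transportDist G m₁ m₂ + t * transportDist G n₁ n₂ + ε := by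
        linear_combination ε * hst

lemma isProb_lazyWalk {V : Type*} [Fintype V] [DecidableEq V] (G : SimpleGraph V)
    [DecidableRel G.Adj] {α : ℝ} (h₀ : 0 ≤ α) (h₁ : α ≤ 1) {x : V} (hx : 0 < G.degree x) :
    IsProb (lazyWalk G α x) := by
  have hdeg : (0 : ℝ) < G.degree x := Nat.cast_pos.2 hx
  have hnonneg : ∀ v, 0 ≤ lazyWalk G α x v := fun v => by
    unfold lazyWalk
    split_ifs
    · exact h₀
    · exact div_nonneg (sub_nonneg.2 h₁) hdeg.le
    · exact le_rfl
  have hsum : ∑ v, lazyWalk G α x v = 1 := by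
    have hsplit : ∀ v, lazyWalk G α x v =
        (if v = x then α else 0) + if G.Adj x v then (1 - α) / G.degree x else 0 := fun v => by
      unfold lazyWalk
      by_cases hv : v = x
      · subst hv; simp
      · simp [hv]
    simp only [hsplit, Finset.sum_add_distrib, Finset.sum_ite_eq', Finset.mem_univ, if_true]
    rw [← Finset.sum_filter, ← SimpleGraph.neighborFinset_eq_filter, Finset.sum_const,
      SimpleGraph.card_neighborFinset_eq_degree, nsmul_eq_mul, mul_div_cancel₀ _ hdeg.ne',
      add_sub_cancel]
  refine ⟨fun v => ⟨hnonneg v, ?_⟩, hsum⟩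
  rw [← hsum]
  exact Finset.single_le_sum (fun w _ => hnonneg w) (Finset.mem_univ v)

lemma lazyWalk_convex_comb {V : Type*} [Fintype V] [DecidableEq V] (G : SimpleGraph V)
    [DecidableRel G.Adj] (α β t : ℝ) (x : V) :
    lazyWalk G (t * α + (1 - t) * β) x =
      fun v => t * lazyWalk G α x v + (1 - t) * lazyWalk G β x v := by
  funext v
  unfold lazyWalk
  split_ifs <;> ring

theorem kappaAlpha_concave {V : Type*} [Fintype V] [DecidableEq V]
    (G : SimpleGraph V) [DecidableRel G.Adj] (hconn : G.Connected)
    (x y : V) (hxy : x ≠ y) :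
    ∀ α ∈ Set.Ico (0 : ℝ) 1, ∀ β ∈ Set.Ico (0 : ℝ) 1, ∀ t ∈ Set.Icc (0 : ℝ) 1,
      t * kappaAlpha G α x y + (1 - t) * kappaAlpha G β x y ≤
        kappaAlpha G (t * α + (1 - t) * β) x y := by
  intro α hα β hβ t ht
  have : Nontrivial V := ⟨x, y, hxy⟩
  have hdeg : ∀ v, 0 < G.degree v := fun v =>
    hconn.preconnected.degree_pos_of_nontrivial v
  have hprob : ∀ γ ∈ Set.Ico (0 : ℝ) 1, ∀ v, IsProb (lazyWalk G γ v) := fun γ hγ v =>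
    isProb_lazyWalk G hγ.1 hγ.2.le (hdeg v)
  have hW := transportDist_convex_comb_le G (hprob α hα x) (hprob α hα y) (hprob β hβ x)
    (hprob β hβ y) ht.1 (sub_nonneg.2 ht.2) (add_sub_cancel t 1)
  rw [← lazyWalk_convex_comb, ← lazyWalk_convex_comb] at hW
  have hdiv := div_le_div_of_nonneg_right hW (Nat.cast_nonneg (α := ℝ) (G.dist x y))
  rw [add_div, mul_div_assoc, mul_div_assoc] at hdiv
  unfold kappaAlpha
  linarith
end
end

section
/- Let G be a finite simple connected graph containing no C3 or C5 as a subgraph, with minimum degree δ, such that κ_LLY(u,v) ≥ κ > 0 for every edge uv of G. Then the number of edges of G satisfies |E(G)| ≤ δ · ∑_{i=0}^{⌊2/κ⌋} C(2/κ − 1, i), where C(s,i) = (∏_{j=0}^{i−1} (s − j)) / i! is the generalized binomial coefficient. -/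
open Finset

noncomputable section

section LevelDistance

variable {W : Type*} {H : SimpleGraph W} {r : W}

lemma dist_le_dist_add_one_of_adj {p q : W} (hp : H.Reachable r p) (h : H.Adj p q) :
    H.dist r q ≤ H.dist r p + 1 := by
  have := hp.dist_triangle_left q
  rwa [SimpleGraph.dist_eq_one_iff_adj.2 h] at this

lemma exists_adj_dist_add_one_eq {q : W} (hq : H.Reachable r q) (h0 : H.dist r q ≠ 0) :
    ∃ p, H.Adj p q ∧ H.Reachable r p ∧ H.dist r p + 1 = H.dist r q := by
  obtain ⟨w, hw⟩ := hq.exists_walk_length_eq_dist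
  have hlen := w.length_reverse
  cases hrev : w.reverse with
  | nil => simp at h0
  | @cons _ p _ h w' =>
    rw [hrev, SimpleGraph.Walk.length_cons] at hlen
    have hp : H.Reachable r p := w'.reverse.reachable
    have h1 := SimpleGraph.dist_le w'.reverse
    rw [SimpleGraph.Walk.length_reverse] at h1
    have h2 := dist_le_dist_add_one_of_adj hp h.symm
    exact ⟨p, h.symm, hp, by omega⟩

lemma dist_eq_add_one_or {p q : W}
    (hne : ∀ p q, H.Reachable r p → H.Adj p q → H.dist r p ≠ H.dist r q)
    (hp : H.Reachable r p) (h : H.Adj p q) :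
    H.dist r q = H.dist r p + 1 ∨ H.dist r q + 1 = H.dist r p := by
  have h1 := dist_le_dist_add_one_of_adj hp h
  have h2 := dist_le_dist_add_one_of_adj (hp.trans h.reachable) h.symm
  have h3 := hne p q hp h
  omega

end LevelDistance

section LevelCounting

variable {W : Type*} [Fintype W] (H : SimpleGraph W) [DecidableRel H.Adj] (r : W)

/-- The neighbours of `p` that are one step farther from the root `r` than `p`. -/
def upNeighbors (p : W) : Finset W :=
  {q ∈ H.neighborFinset p | H.dist r q = H.dist r p + 1}

/-- The neighbours of `p` that are one step closer to the root `r` than `p`. -/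
def downNeighbors (p : W) : Finset W :=
  {q ∈ H.neighborFinset p | H.dist r q + 1 = H.dist r p}

open Classical in
/-- The vertices of the component of `r` at distance `i` from `r`. -/
def level (i : ℕ) : Finset W :=
  {p | H.Reachable r p ∧ H.dist r p = i}

variable {H r}

lemma graphLap_dist_le_one {p : W} (hp : H.Reachable r p) :
    graphLap H (fun q ↦ (H.dist r q : ℝ)) p ≤ 1 := by
  have hsum : ∑ q ∈ H.neighborFinset p, ((H.dist r q : ℝ) - H.dist r p) ≤ H.degree p := by
    rw [← SimpleGraph.card_neighborFinset_eq_degree, card_eq_sum_ones, Nat.cast_sum]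
    refine sum_le_sum fun q hq ↦ ?_
    have := dist_le_dist_add_one_of_adj hp ((H.mem_neighborFinset p q).1 hq)
    have : (H.dist r q : ℝ) ≤ H.dist r p + 1 := by exact_mod_cast this
    push_cast
    linarith
  unfold graphLap
  rw [inv_mul_eq_div]
  exact div_le_one_of_le₀ hsum (Nat.cast_nonneg _)

lemma graphLap_dist_le {κ : ℝ}
    (hlap : ∀ p q, H.Reachable r p → H.Adj p q → H.dist r q = H.dist r p + 1 →
      κ ≤ graphLap H (fun w ↦ (H.dist r w : ℝ)) p - graphLap H (fun w ↦ (H.dist r w : ℝ)) q)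
    {p : W} (hp : H.Reachable r p) :
    graphLap H (fun w ↦ (H.dist r w : ℝ)) p ≤ 1 - κ * H.dist r p := by
  induction hn : H.dist r p generalizing p with
  | zero => simpa using graphLap_dist_le_one hp
  | succ n ih =>
    obtain ⟨o, hop, ho, hd⟩ := exists_adj_dist_add_one_eq hp (by omega)
    have h1 := ih ho (by omega)
    have h2 := hlap o p ho hop hd.symm
    push_cast
    linarith

lemma card_up_add_card_down
    (hne : ∀ p q, H.Reachable r p → H.Adj p q → H.dist r p ≠ H.dist r q)
    {p : W} (hp : H.Reachable r p) :
    (#(upNeighbors H r p) : ℝ) + #(downNeighbors H r p) = H.degree p := by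
  rw [upNeighbors, downNeighbors, ← sum_boole, ← sum_boole, ← sum_add_distrib,
    ← SimpleGraph.card_neighborFinset_eq_degree, card_eq_sum_ones, Nat.cast_sum]
  refine sum_congr rfl fun q hq ↦ ?_
  rcases dist_eq_add_one_or hne hp ((H.mem_neighborFinset p q).1 hq) with h | h
  · simp [h, add_assoc]
  · simp [← h, add_assoc]

lemma sum_dist_sub_dist
    (hne : ∀ p q, H.Reachable r p → H.Adj p q → H.dist r p ≠ H.dist r q)
    {p : W} (hp : H.Reachable r p) :
    ∑ q ∈ H.neighborFinset p, ((H.dist r q : ℝ) - H.dist r p) =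
      #(upNeighbors H r p) - #(downNeighbors H r p) := by
  rw [upNeighbors, downNeighbors, ← sum_boole, ← sum_boole, ← sum_sub_distrib]
  refine sum_congr rfl fun q hq ↦ ?_
  rcases dist_eq_add_one_or hne hp ((H.mem_neighborFinset p q).1 hq) with h | h
  · simp [h, add_assoc]
  · simp [← h, add_assoc]

lemma degree_mul_dist_le_card_down {κ : ℝ}
    (hne : ∀ p q, H.Reachable r p → H.Adj p q → H.dist r p ≠ H.dist r q)
    (hlap : ∀ p q, H.Reachable r p → H.Adj p q → H.dist r q = H.dist r p + 1 →
      κ ≤ graphLap H (fun w ↦ (H.dist r w : ℝ)) p - graphLap H (fun w ↦ (H.dist r w : ℝ)) q)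
    {p : W} (hp : H.Reachable r p) :
    H.degree p * (κ * H.dist r p) ≤ 2 * #(downNeighbors H r p) := by
  have h1 := graphLap_dist_le hlap hp
  have h2 := card_up_add_card_down hne hp
  rcases Nat.eq_zero_or_pos (H.degree p) with h0 | hpos
  · rw [h0]; simp
  have hpos' : (0 : ℝ) < H.degree p := by exact_mod_cast hpos
  rw [graphLap, sum_dist_sub_dist hne hp, inv_mul_eq_div, div_le_iff₀ hpos'] at h1
  linarith

lemma mul_dist_le_two {κ : ℝ}
    (hne : ∀ p q, H.Reachable r p → H.Adj p q → H.dist r p ≠ H.dist r q)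
    (hlap : ∀ p q, H.Reachable r p → H.Adj p q → H.dist r q = H.dist r p + 1 →
      κ ≤ graphLap H (fun w ↦ (H.dist r w : ℝ)) p - graphLap H (fun w ↦ (H.dist r w : ℝ)) q)
    {p : W} (hp : H.Reachable r p) : κ * H.dist r p ≤ 2 := by
  rcases eq_or_ne (H.dist r p) 0 with h0 | h0
  · simp [h0]
  obtain ⟨o, hop, -, -⟩ := exists_adj_dist_add_one_eq hp h0
  have hpos : 0 < H.degree p := (H.degree_pos_iff_exists_adj p).2 ⟨o, hop.symm⟩
  have hpos' : (0 : ℝ) < H.degree p := by exact_mod_cast hpos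
  have h1 := degree_mul_dist_le_card_down hne hlap hp
  have h2 := card_up_add_card_down hne hp
  have h3 : (0 : ℝ) ≤ #(upNeighbors H r p) := Nat.cast_nonneg _
  refine le_of_mul_le_mul_left ?_ hpos'
  linarith

lemma dist_mul_card_up_le {κ : ℝ} (hκ : 0 < κ)
    (hne : ∀ p q, H.Reachable r p → H.Adj p q → H.dist r p ≠ H.dist r q)
    (hlap : ∀ p q, H.Reachable r p → H.Adj p q → H.dist r q = H.dist r p + 1 →
      κ ≤ graphLap H (fun w ↦ (H.dist r w : ℝ)) p - graphLap H (fun w ↦ (H.dist r w : ℝ)) q)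
    {p : W} (hp : H.Reachable r p) :
    H.dist r p * (#(upNeighbors H r p) : ℝ) ≤
      (2 / κ - H.dist r p) * #(downNeighbors H r p) := by
  have h1 := degree_mul_dist_le_card_down hne hlap hp
  rw [← card_up_add_card_down hne hp] at h1
  have h2 : (2 / κ - H.dist r p) * #(downNeighbors H r p) - H.dist r p * #(upNeighbors H r p) =
      (2 * #(downNeighbors H r p) -
        (#(upNeighbors H r p) + #(downNeighbors H r p)) * (κ * H.dist r p)) / κ := by
    field_simp
    ring
  rw [← sub_nonneg, h2]
  exact div_nonneg (sub_nonneg.2 h1) hκ.le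

lemma sum_card_down_level (i : ℕ) :
    ∑ p ∈ level H r (i + 1), #(downNeighbors H r p) = ∑ p ∈ level H r i, #(upNeighbors H r p) := by
  have key := sum_card_bipartiteAbove_eq_sum_card_bipartiteBelow
    (s := level H r (i + 1)) (t := level H r i) H.Adj
  refine Eq.trans (sum_congr rfl fun p hp ↦ congrArg card ?_)
    (key.trans (sum_congr rfl fun p hp ↦ congrArg card ?_))
  · ext q
    simp only [level, mem_filter, mem_univ, true_and] at hp
    simp only [downNeighbors, bipartiteAbove, level, mem_filter, mem_univ, true_and,
      SimpleGraph.mem_neighborFinset]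
    constructor
    · rintro ⟨h, hd⟩
      exact ⟨⟨hp.1.trans h.reachable, by omega⟩, h⟩
    · rintro ⟨⟨-, hd⟩, h⟩
      exact ⟨h, by omega⟩
  · ext q
    simp only [level, mem_filter, mem_univ, true_and] at hp
    simp only [upNeighbors, bipartiteBelow, level, mem_filter, mem_univ, true_and,
      SimpleGraph.mem_neighborFinset]
    constructor
    · rintro ⟨⟨-, hd⟩, h⟩
      exact ⟨h.symm, by omega⟩
    · rintro ⟨h, hd⟩
      exact ⟨⟨hp.1.trans h.reachable, by omega⟩, h.symm⟩

lemma succ_mul_sum_card_up_le {κ : ℝ} (hκ : 0 < κ)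
    (hne : ∀ p q, H.Reachable r p → H.Adj p q → H.dist r p ≠ H.dist r q)
    (hlap : ∀ p q, H.Reachable r p → H.Adj p q → H.dist r q = H.dist r p + 1 →
      κ ≤ graphLap H (fun w ↦ (H.dist r w : ℝ)) p - graphLap H (fun w ↦ (H.dist r w : ℝ)) q)
    (i : ℕ) :
    ((i : ℝ) + 1) * ∑ p ∈ level H r (i + 1), (#(upNeighbors H r p) : ℝ) ≤
      (2 / κ - 1 - i) * ∑ p ∈ level H r i, (#(upNeighbors H r p) : ℝ) := by
  have h := sum_card_down_level (H := H) (r := r) i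
  rw [← Nat.cast_sum (level H r i), ← h, Nat.cast_sum, mul_sum, mul_sum]
  refine sum_le_sum fun p hp ↦ ?_
  simp only [level, mem_filter, mem_univ, true_and] at hp
  have := dist_mul_card_up_le hκ hne hlap hp.1
  rw [hp.2] at this
  push_cast at this
  linarith

lemma sum_card_up_level_zero : ∑ p ∈ level H r 0, #(upNeighbors H r p) = H.degree r := by
  have h0 : level H r 0 = {r} := by
    ext p
    simp only [level, mem_filter, mem_univ, true_and, mem_singleton]
    constructor
    · rintro ⟨h, hd⟩
      exact (h.dist_eq_zero_iff.1 hd).symm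
    · rintro rfl
      exact ⟨.rfl, SimpleGraph.dist_self⟩
  rw [h0, sum_singleton, ← SimpleGraph.card_neighborFinset_eq_degree, upNeighbors]
  congr 1
  refine filter_true_of_mem fun q hq ↦ ?_
  simpa using hq

lemma sum_card_up_level_le {κ : ℝ} (hκ : 0 < κ)
    (hne : ∀ p q, H.Reachable r p → H.Adj p q → H.dist r p ≠ H.dist r q)
    (hlap : ∀ p q, H.Reachable r p → H.Adj p q → H.dist r q = H.dist r p + 1 →
      κ ≤ graphLap H (fun w ↦ (H.dist r w : ℝ)) p - graphLap H (fun w ↦ (H.dist r w : ℝ)) q)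
    {i : ℕ} (hi : i ≤ ⌊2 / κ⌋₊) :
    ∑ p ∈ level H r i, (#(upNeighbors H r p) : ℝ) ≤
      H.degree r * ((∏ j ∈ range i, (2 / κ - 1 - j)) / i.factorial) := by
  induction i with
  | zero =>
    rw [← sum_card_up_level_zero]
    simp
  | succ i ih =>
    have hstep := succ_mul_sum_card_up_le hκ hne hlap i
    have hle : ((i + 1 : ℕ) : ℝ) ≤ 2 / κ := (Nat.le_floor_iff (by positivity)).1 hi
    push_cast at hle
    have hmul := mul_le_mul_of_nonneg_left (ih (by omega)) (a := 2 / κ - 1 - i) (by linarith)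
    refine le_of_mul_le_mul_left ((hstep.trans hmul).trans_eq ?_)
      (by positivity : (0 : ℝ) < (i : ℝ) + 1)
    rw [prod_range_succ, Nat.factorial_succ]
    push_cast
    have : (i.factorial : ℝ) ≠ 0 := by positivity
    have : (i : ℝ) + 1 ≠ 0 := by positivity
    generalize ∏ j ∈ range i, (2 / κ - 1 - (j : ℝ)) = P
    generalize 2 / κ - 1 - (i : ℝ) = t
    field_simp

open Classical in
lemma sum_card_up_le {κ : ℝ} (hκ : 0 < κ)
    (hne : ∀ p q, H.Reachable r p → H.Adj p q → H.dist r p ≠ H.dist r q)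
    (hlap : ∀ p q, H.Reachable r p → H.Adj p q → H.dist r q = H.dist r p + 1 →
      κ ≤ graphLap H (fun w ↦ (H.dist r w : ℝ)) p - graphLap H (fun w ↦ (H.dist r w : ℝ)) q) :
    ∑ p with H.Reachable r p, (#(upNeighbors H r p) : ℝ) ≤
      H.degree r * ∑ i ∈ range (⌊2 / κ⌋₊ + 1),
        (∏ j ∈ range i, (2 / κ - 1 - j)) / i.factorial := by
  have hmaps : ∀ p ∈ ({p | H.Reachable r p} : Finset W), H.dist r p ∈ range (⌊2 / κ⌋₊ + 1) := by
    intro p hp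
    rw [mem_range, Nat.lt_succ_iff]
    refine Nat.le_floor ?_
    rw [le_div_iff₀' hκ]
    exact mul_dist_le_two hne hlap (by simpa using hp)
  rw [← sum_fiberwise_of_maps_to hmaps, mul_sum]
  refine sum_le_sum fun i hi ↦ ?_
  rw [filter_filter]
  exact sum_card_up_level_le hκ hne hlap (Nat.lt_succ_iff.1 (mem_range.1 hi))

end LevelCounting

section Cycles

variable {V : Type*} {G : SimpleGraph V}

lemma not_closed_three_walk (h3 : ¬ HasCycleLen G 3) {a b c : V} (hab : G.Adj a b)
    (hbc : G.Adj b c) (hca : G.Adj c a) : False := by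
  refine h3 ⟨![a, b, c], ?_, ?_⟩
  · intro i j
    have := hab.ne; have := hbc.ne; have := hca.ne
    fin_cases i <;> fin_cases j <;> simp_all [eq_comm]
  · intro i
    fin_cases i <;> assumption

lemma not_closed_five_walk (h3 : ¬ HasCycleLen G 3) (h5 : ¬ HasCycleLen G 5) {a b c d e : V}
    (hab : G.Adj a b) (hbc : G.Adj b c) (hcd : G.Adj c d) (hde : G.Adj d e) (hea : G.Adj e a) :
    False := by
  have hac : a ≠ c := by rintro rfl; exact not_closed_three_walk h3 hcd hde hea
  have hbd : b ≠ d := by rintro rfl; exact not_closed_three_walk h3 hde hea hab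
  have hce : c ≠ e := by rintro rfl; exact not_closed_three_walk h3 hea hab hbc
  have hda : d ≠ a := by rintro rfl; exact not_closed_three_walk h3 hab hbc hcd
  have heb : e ≠ b := by rintro rfl; exact not_closed_three_walk h3 hbc hcd hde
  refine h5 ⟨![a, b, c, d, e], ?_, ?_⟩
  · intro i j
    have := hab.ne; have := hbc.ne; have := hcd.ne; have := hde.ne; have := hea.ne
    fin_cases i <;> fin_cases j <;> simp_all [eq_comm]
  · intro i
    fin_cases i <;> assumption

end Cycles

section Curvature

variable {V : Type*} {G : SimpleGraph V}

/-- McShane extension of a function that is 1-Lipschitz on a finite set. -/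
lemma exists_isLip1_extension_s17 (hconn : G.Connected) {S : Finset V} (hS : S.Nonempty) {f : V → ℝ}
    (hf : ∀ a ∈ S, ∀ b ∈ S, f a - f b ≤ G.dist a b) :
    ∃ g : V → ℝ, IsLip1 G g ∧ ∀ a ∈ S, g a = f a := by
  have hlip (x y : V) : S.inf' hS (fun a ↦ f a + G.dist a x) ≤
      S.inf' hS (fun a ↦ f a + G.dist a y) + G.dist x y := by
    rw [← sub_le_iff_le_add]
    refine le_inf' _ _ fun a ha ↦ ?_
    have h1 := inf'_le (fun a ↦ f a + (G.dist a x : ℝ)) ha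
    have h2 : (G.dist a x : ℝ) ≤ G.dist a y + G.dist y x := by
      exact_mod_cast hconn.dist_triangle
    rw [G.dist_comm (u := y)] at h2
    linarith
  refine ⟨fun x ↦ S.inf' hS fun a ↦ f a + G.dist a x, fun u v ↦ ?_, fun a ha ↦ ?_⟩
  · have h1 := hlip u v
    have h2 := hlip v u
    rw [G.dist_comm] at h2
    exact abs_sub_le_iff.2 ⟨by linarith, by linarith⟩
  · apply le_antisymm
    · exact (inf'_le (fun b ↦ f b + (G.dist b a : ℝ)) ha).trans (by simp)
    · refine le_inf' _ _ fun b hb ↦ ?_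
      have := hf a ha b hb
      rw [G.dist_comm] at this
      linarith

variable [Fintype V] [DecidableRel G.Adj]

lemma abs_graphLap_le_one {f : V → ℝ} (hf : IsLip1 G f) (x : V) : |graphLap G f x| ≤ 1 := by
  have hsum : |∑ y ∈ G.neighborFinset x, (f y - f x)| ≤ G.degree x := by
    refine (abs_sum_le_sum_abs _ _).trans ?_
    rw [← SimpleGraph.card_neighborFinset_eq_degree, card_eq_sum_ones, Nat.cast_sum]
    refine sum_le_sum fun y hy ↦ ?_
    have := hf y x
    rwa [SimpleGraph.dist_eq_one_iff_adj.2 ((G.mem_neighborFinset x y).1 hy).symm] at this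
  rw [graphLap, inv_mul_eq_div, abs_div, Nat.abs_cast]
  exact div_le_one_of_le₀ hsum (Nat.cast_nonneg _)

lemma kappaLLY_le_of_adj {x y : V} (hxy : G.Adj x y) {f : V → ℝ} (hf : IsLip1 G f)
    (hfxy : f y - f x = 1) : kappaLLY G x y ≤ graphLap G f x - graphLap G f y := by
  have hd : G.dist x y = 1 := SimpleGraph.dist_eq_one_iff_adj.2 hxy
  refine csInf_le ⟨-2, ?_⟩ ⟨f, hf, by simpa [hd] using hfxy, by simp [hd]⟩
  rintro _ ⟨g, hg, -, rfl⟩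
  have h1 := abs_le.1 (abs_graphLap_le_one hg x)
  have h2 := abs_le.1 (abs_graphLap_le_one hg y)
  simp only [hd, Nat.cast_one, div_one]
  linarith

end Curvature

section BoolCover

variable {V : Type*}

/-- The bipartite double cover of `G`, with vertices indexed by `V × Bool`. -/
def boolCover (G : SimpleGraph V) : SimpleGraph (V × Bool) where
  Adj p q := G.Adj p.1 q.1 ∧ q.2 = !p.2
  symm := ⟨fun p q h ↦ ⟨h.1.symm, by simp [h.2]⟩⟩
  loopless := ⟨fun p h ↦ G.loopless.irrefl p.1 h.1⟩

variable {G : SimpleGraph V}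

instance [DecidableRel G.Adj] : DecidableRel (boolCover G).Adj :=
  fun p q ↦ inferInstanceAs (Decidable (G.Adj p.1 q.1 ∧ q.2 = !p.2))

lemma boolCover_dist_ne {r p q : V × Bool} (hp : (boolCover G).Reachable r p)
    (h : (boolCover G).Adj p q) : (boolCover G).dist r p ≠ (boolCover G).dist r q := by
  let c : (boolCover G).Coloring Bool :=
    SimpleGraph.Coloring.mk Prod.snd fun {a b} hab ↦ by simp [hab.2]
  obtain ⟨w, hw⟩ := hp.exists_walk_length_eq_dist
  obtain ⟨w', hw'⟩ := (hp.trans h.reachable).exists_walk_length_eq_dist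
  have h1 := c.even_length_iff_congr w
  have h2 := c.even_length_iff_congr w'
  have hcp : c p = p.2 := rfl
  have hcq : c q = !p.2 := h.2
  rw [hw, hcp] at h1
  rw [hw', hcq] at h2
  intro heq
  rw [heq, h2] at h1
  revert h1
  cases c r <;> cases p.2 <;> simp

lemma exists_boolCover_reachable (hconn : G.Connected) (x a : V) :
    ∃ b, (boolCover G).Reachable (x, false) (a, b) := by
  obtain ⟨w⟩ := hconn x a
  generalize false = t
  induction w generalizing t with
  | nil => exact ⟨t, .rfl⟩
  | @cons u v _ h _ ih =>
    obtain ⟨b, hb⟩ := ih (!t)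
    have hadj : (boolCover G).Adj (u, t) (v, !t) := ⟨h, rfl⟩
    exact ⟨b, hadj.reachable.trans hb⟩

variable [Fintype V] [DecidableRel G.Adj]

lemma neighborFinset_boolCover [DecidableEq V] (p : V × Bool) :
    (boolCover G).neighborFinset p =
      (G.neighborFinset p.1).map ⟨fun y ↦ (y, !p.2), fun _ _ h ↦ (Prod.ext_iff.1 h).1⟩ := by
  ext q
  simp only [SimpleGraph.mem_neighborFinset, mem_map]
  constructor
  · intro h
    exact ⟨q.1, h.1, Prod.ext rfl h.2.symm⟩
  · rintro ⟨y, hy, rfl⟩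
    exact ⟨hy, rfl⟩

lemma degree_boolCover [DecidableEq V] (p : V × Bool) :
    (boolCover G).degree p = G.degree p.1 := by
  rw [← SimpleGraph.card_neighborFinset_eq_degree, neighborFinset_boolCover, card_map,
    SimpleGraph.card_neighborFinset_eq_degree]

lemma graphLap_boolCover [DecidableEq V] {f : V → ℝ} {F : V × Bool → ℝ} {p : V × Bool}
    (hp : f p.1 = F p) (hN : ∀ y, G.Adj p.1 y → f y = F (y, !p.2)) :
    graphLap (boolCover G) F p = graphLap G f p.1 := by
  rw [graphLap, graphLap, degree_boolCover, neighborFinset_boolCover, sum_map]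
  congr 1
  refine sum_congr rfl fun y hy ↦ ?_
  rw [hp, hN y ((G.mem_neighborFinset _ _).1 hy)]
  rfl

/-- In a graph without closed walks of length 3 or 5, curvature bounds pass to the parity-respecting
distance function of the double cover. -/
lemma le_graphLap_boolCover_sub [DecidableEq V] (hconn : G.Connected) (h3 : ¬ HasCycleLen G 3)
    (h5 : ¬ HasCycleLen G 5) {κ : ℝ} (hcurv : ∀ u v : V, G.Adj u v → κ ≤ kappaLLY G u v)
    {r p q : V × Bool} (hp : (boolCover G).Reachable r p) (hpq : (boolCover G).Adj p q)
    (hd : (boolCover G).dist r q = (boolCover G).dist r p + 1) :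
    κ ≤ graphLap (boolCover G) (fun w ↦ ((boolCover G).dist r w : ℝ)) p -
      graphLap (boolCover G) (fun w ↦ ((boolCover G).dist r w : ℝ)) q := by
  have hq := hp.trans hpq.reachable
  obtain ⟨u, t⟩ := p
  obtain ⟨v, t'⟩ := q
  obtain ⟨huv, rfl⟩ : G.Adj u v ∧ t' = !t := hpq
  set D := (boolCover G).dist r
  have htri {a b c : V} (hab : G.Adj a b) (hbc : G.Adj b c) : ¬ G.Adj a c := fun hac ↦
    not_closed_three_walk h3 hab hbc hac.symm
  have hstep {a b : V} {s : Bool} (h : (boolCover G).Reachable r (a, s)) (hab : G.Adj a b) :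
      D (b, !s) ≤ D (a, s) + 1 ∧ D (a, s) ≤ D (b, !s) + 1 := by
    have hadj : (boolCover G).Adj (a, s) (b, !s) := ⟨hab, rfl⟩
    exact ⟨dist_le_dist_add_one_of_adj h hadj,
      dist_le_dist_add_one_of_adj (h.trans hadj.reachable) hadj.symm⟩
  have hstepv {b : V} (hb : G.Adj v b) : D (b, t) ≤ D (v, !t) + 1 ∧ D (v, !t) ≤ D (b, t) + 1 := by
    simpa using hstep hq hb
  have htwo {a b c : V} (ha : G.Adj c a) (hb : G.Adj c b) (hne : a ≠ b) : 2 ≤ G.dist a b :=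
    hconn.one_lt_dist_of_ne_of_not_adj hne (htri ha.symm hb)
  have hcross {a b : V} (ha : G.Adj u a) (hb : G.Adj v b) :
      D (a, !t) ≤ D (b, t) + G.dist a b ∧ D (b, t) ≤ D (a, !t) + G.dist a b := by
    have h0 : G.dist a b ≠ 0 := by
      intro h
      obtain rfl := hconn.dist_eq_zero_iff.1 h
      exact htri huv hb ha
    by_cases h1 : G.dist a b = 1
    · have hra : (boolCover G).Reachable r (a, !t) :=
        hp.trans (SimpleGraph.Adj.reachable (G := boolCover G) ⟨ha, rfl⟩)
      have := hstep hra (SimpleGraph.dist_eq_one_iff_adj.1 h1)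
      rw [Bool.not_not] at this
      omega
    · have h2 : G.dist a b ≠ 2 := by
        intro h
        obtain ⟨w, hw⟩ := hconn.exists_walk_length_eq_dist a b
        rw [h] at hw
        have hac := w.adj_getVert_succ (i := 0) (by omega)
        have hcb := w.adj_getVert_succ (i := 1) (by omega)
        rw [SimpleGraph.Walk.getVert_zero] at hac
        rw [w.getVert_of_length_le hw.le] at hcb
        exact not_closed_five_walk h3 h5 hac hcb hb.symm huv.symm ha
      have := hstep hp ha
      have := hstepv hb
      omega
  let f₀ : V → ℝ := fun x ↦ if G.Adj u x then D (x, !t) else D (x, t)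
  have hf₀u {x : V} (hx : G.Adj u x) : f₀ x = D (x, !t) := if_pos hx
  have hf₀v {x : V} (hx : G.Adj v x) : f₀ x = D (x, t) := if_neg (htri huv hx)
  obtain ⟨f, hf, hfS⟩ := exists_isLip1_extension_s17 hconn
    (S := G.neighborFinset u ∪ G.neighborFinset v) (f := f₀) ⟨v, by simp [huv]⟩ (by
      intro a ha b hb
      rw [sub_le_iff_le_add']
      rcases eq_or_ne a b with rfl | hne
      · simp
      simp only [mem_union, SimpleGraph.mem_neighborFinset] at ha hb
      rcases ha with ha | ha <;> rcases hb with hb | hb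
      · rw [hf₀u ha, hf₀u hb]
        have := hstep hp ha
        have := hstep hp hb
        have := htwo ha hb hne
        norm_cast
        omega
      · rw [hf₀u ha, hf₀v hb]
        exact_mod_cast (hcross ha hb).1
      · rw [hf₀v ha, hf₀u hb, G.dist_comm]
        exact_mod_cast (hcross hb ha).2
      · rw [hf₀v ha, hf₀v hb]
        have := hstepv ha
        have := hstepv hb
        have := htwo ha hb hne
        norm_cast
        omega)
  have hfu {x : V} (hx : G.Adj u x) : f x = D (x, !t) := by
    rw [hfS x (by simp [hx]), hf₀u hx]
  have hfv {x : V} (hx : G.Adj v x) : f x = D (x, t) := by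
    rw [hfS x (by simp [hx]), hf₀v hx]
  rw [graphLap_boolCover (f := f) (hfv huv.symm) fun y hy ↦ hfu hy,
    graphLap_boolCover (f := f) (hfu huv) fun y hy ↦ by rw [hfv hy, Bool.not_not]]
  refine (hcurv u v huv).trans (kappaLLY_le_of_adj huv hf ?_)
  rw [hfu huv, hfv huv.symm, hd]
  push_cast
  ring

open Classical in
lemma card_edgeFinset_le_sum_card_up (hconn : G.Connected) (x : V) :
    #G.edgeFinset ≤
      ∑ p with (boolCover G).Reachable (x, false) p, #(upNeighbors (boolCover G) (x, false) p) := by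
  rw [← card_sigma]
  refine card_le_card_of_surjOn (fun pq ↦ s(pq.1.1, pq.2.1)) ?_
  intro e he
  induction e with | h a b => ?_
  have hab : G.Adj a b := by simpa using he
  obtain ⟨t, ht⟩ := exists_boolCover_reachable hconn x a
  have hadj : (boolCover G).Adj (a, t) (b, !t) := ⟨hab, rfl⟩
  have hr := ht.trans hadj.reachable
  rcases dist_eq_add_one_or (fun _ _ ↦ boolCover_dist_ne) ht hadj with h | h
  · exact ⟨⟨(a, t), (b, !t)⟩, by simp [upNeighbors, ht, hadj, h], rfl⟩
  · exact ⟨⟨(b, !t), (a, t)⟩, by simp [upNeighbors, hr, hadj.symm, h], Sym2.eq_swap⟩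

end BoolCover

theorem edge_bound_C3C5_free {V : Type*} [Fintype V] [DecidableEq V] (G : SimpleGraph V)
    [DecidableRel G.Adj] (hconn : G.Connected)
    (h3 : ¬ HasCycleLen G 3) (h5 : ¬ HasCycleLen G 5)
    (κ : ℝ) (hκ : 0 < κ)
    (hcurv : ∀ u v : V, G.Adj u v → κ ≤ kappaLLY G u v) :
    (G.edgeFinset.card : ℝ) ≤ (G.minDegree : ℝ) *
      ∑ i ∈ Finset.range (⌊2 / κ⌋₊ + 1),
        (∏ j ∈ Finset.range i, (2 / κ - 1 - j)) / (Nat.factorial i) := by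
  classical
  have := hconn.nonempty
  obtain ⟨x, hx⟩ := G.exists_minimal_degree_vertex
  have h := sum_card_up_le (r := (x, false)) hκ (fun _ _ ↦ boolCover_dist_ne)
    fun _ _ ↦ le_graphLap_boolCover_sub hconn h3 h5 hcurv
  rw [degree_boolCover, ← hx] at h
  refine le_trans ?_ h
  rw [← Nat.cast_sum, Nat.cast_le]
  convert card_edgeFinset_le_sum_card_up hconn x
end
end
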